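/- arXiv:1709.06724 — 4 statements merged into one kernel-verified Lean document; each statement's English description precedes it below -/
import Mathlib

section
/- Let f ∈ ℤ[x] be monic of degree n, and let H be an n×n nonsingular integer matrix in Hermite Normal Form (lower-triangular convention) whose rows span an ideal lattice for f (the ℤ-span of the rows is closed under the map 'multiply by x and reduce mod f' on coefficient vectors). Then the diagonal entries form a division chain: h_{n,n} ∣ h_{n−1,n−1} ∣ ⋯ ∣ h_{2,2} ∣ h_{1,1}. -/
open Polynomial

/-- If `w` is an integer combination of the rows of a lower-triangular matrix with nonzero diagonal
and `w` vanishes beyond position `m`, then the `m`-th diagonal entry divides `w m`. -/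
theorem diag_dvd_of_mem_span_rows {n : ℕ} {H : Matrix (Fin n) (Fin n) ℤ}
    (hdiag : ∀ i : Fin n, H i i ≠ 0) (hupper : ∀ j i : Fin n, j < i → H j i = 0)
    {w : Fin n → ℤ} (hw : w ∈ Submodule.span ℤ (Set.range fun i : Fin n => H i))
    {m : Fin n} (hm : ∀ k, m < k → w k = 0) : H m m ∣ w m := by
  obtain ⟨c, rfl⟩ := (Submodule.mem_span_range_iff_exists_fun ℤ).1 hw
  have apply_eq : ∀ k, (∀ l, k < l → c l = 0) →
      (∑ i, c i • H i) k = c k * H k k := by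
    intro k hk
    rw [Finset.sum_apply, Finset.sum_eq_single k]
    · rfl
    · intro l _ hl
      rcases lt_or_gt_of_ne hl with h | h
      · simp [hupper l k h]
      · simp [hk l h]
    · simp
  have c_eq_zero : ∀ k, m < k → c k = 0 := by
    intro k
    induction k using WellFoundedGT.induction with
    | ind k ih =>
      intro hk
      have h := hm k hk
      rw [apply_eq k fun l hl => ih l hl (hk.trans hl)] at h
      exact (mul_eq_zero.1 h).resolve_right (hdiag k)
  exact ⟨c m, by rw [apply_eq m c_eq_zero, mul_comm]⟩

/-- The coefficients of the polynomial attached to a vector. -/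
theorem coeff_sum_C_mul_X_pow_fin {n : ℕ} (v : Fin n → ℤ) (k : Fin n) :
    (∑ l : Fin n, C (v l) * X ^ (l : ℕ)).coeff (k : ℕ) = v k := by
  simp [coeff_X_pow, Fin.val_inj]

/-- If `v` vanishes beyond position `i` and `i + 1 < n = deg f`, then multiplying by `X` does not
wrap around modulo `f`. -/
theorem X_mul_sum_modByMonic_eq_self {n : ℕ} {f : ℤ[X]} (hf : f.Monic) (hfdeg : f.natDegree = n)
    {v : Fin n → ℤ} {i : ℕ} (hi : i + 1 < n) (hv : ∀ k : Fin n, i < k → v k = 0) :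
    (X * ∑ k : Fin n, C (v k) * X ^ (k : ℕ)) %ₘ f = X * ∑ k : Fin n, C (v k) * X ^ (k : ℕ) := by
  have hdeg : (∑ k : Fin n, C (v k) * X ^ (k : ℕ)).natDegree ≤ i := by
    refine natDegree_sum_le_of_forall_le _ _ fun k _ => ?_
    by_cases hk : i < k
    · simp [hv k hk]
    · exact (natDegree_C_mul_X_pow_le _ _).trans (not_lt.1 hk)
  rw [modByMonic_eq_self_iff hf, degree_eq_natDegree hf.ne_zero, hfdeg]
  refine degree_le_natDegree.trans_lt (Nat.cast_lt.2 ?_)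
  have := natDegree_mul_le (p := (X : ℤ[X])) (q := ∑ k : Fin n, C (v k) * X ^ (k : ℕ))
  have := natDegree_X_le (R := ℤ)
  omega

/-- If `H` is a nonsingular integer matrix in Hermite Normal Form
(lower-triangular convention) whose rows span an ideal lattice for a monic `f` of degree
`n` (i.e. the ℤ-span of the rows is closed under `p ↦ x·p mod f` on coefficient vectors),
then the diagonal entries form a division chain:
`h_{n,n} ∣ h_{n−1,n−1} ∣ ⋯ ∣ h_{1,1}`, i.e. `h_{j,j} ∣ h_{i,i}` whenever `i ≤ j`. -/
theorem hnf_ideal_lattice_diag_division_chain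
    (n : ℕ) (f : Polynomial ℤ) (hf : f.Monic) (hfdeg : f.natDegree = n)
    (H : Matrix (Fin n) (Fin n) ℤ)
    (hdet : H.det ≠ 0)
    (hdiagpos : ∀ i : Fin n, 0 < H i i)
    (hupper : ∀ j i : Fin n, j < i → H j i = 0)
    (hreduced : ∀ i j : Fin n, i < j → 0 ≤ H j i ∧ H j i < H i i)
    (hclosed : ∀ v : Fin n → ℤ,
      v ∈ Submodule.span ℤ (Set.range fun i : Fin n => H i) →
      (fun j : Fin n => ((X * ∑ k : Fin n, C (v k) * X ^ (k : ℕ)) %ₘ f).coeff (j : ℕ))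
        ∈ Submodule.span ℤ (Set.range fun i : Fin n => H i)) :
    ∀ i j : Fin n, i ≤ j → H j j ∣ H i i := by
  have step : ∀ (i : ℕ) (hi : i + 1 < n),
      H ⟨i + 1, hi⟩ ⟨i + 1, hi⟩ ∣ H ⟨i, by omega⟩ ⟨i, by omega⟩ := by
    intro i hi
    have coeff_succ : ∀ (k : ℕ) (hk : k + 1 < n),
        ((X * ∑ l : Fin n, C (H ⟨i, by omega⟩ l) * X ^ (l : ℕ)) %ₘ f).coeff (k + 1) =
          H ⟨i, by omega⟩ ⟨k, by omega⟩ := by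
      intro k hk
      rw [X_mul_sum_modByMonic_eq_self hf hfdeg hi fun l hl => hupper _ _ hl, coeff_X_mul]
      exact coeff_sum_C_mul_X_pow_fin (H ⟨i, by omega⟩) ⟨k, by omega⟩
    have h := diag_dvd_of_mem_span_rows (fun k => (hdiagpos k).ne') hupper
      (hclosed _ (Submodule.subset_span ⟨⟨i, by omega⟩, rfl⟩)) (m := ⟨i + 1, hi⟩) ?_
    · simpa only [coeff_succ i hi] using h
    · rintro ⟨_ | k, hk⟩ hik
      · simp [Fin.lt_def] at hik
      · rw [Fin.mk_lt_mk] at hik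
        exact (coeff_succ k hk).trans (hupper _ _ (Fin.mk_lt_mk.2 (by omega)))
  rintro ⟨i, hi⟩ ⟨j, hj⟩ hij
  rw [Fin.mk_le_mk] at hij
  induction j, hij using Nat.le_induction with
  | base => exact dvd_rfl
  | succ k _ ih => exact (step k hj).trans (ih (by omega))
end

section
/- Let f ∈ ℤ[x] be monic of degree n, and let H be an n×n nonsingular integer matrix in Hermite Normal Form (lower-triangular convention) whose rows span an ideal lattice for f. Let β be the integer root of h_{2,1} + h_{2,2}x (which exists since h_{2,2} ∣ h_{2,1}). Then the integer h_{1,1}/h_{2,2} divides f(β). -/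
open Polynomial

theorem coeff_sum_C_mul_X_pow {n : ℕ} (v : Fin n → ℤ) (m : ℕ) :
    (∑ k : Fin n, C (v k) * X ^ (k : ℕ)).coeff m = if h : m < n then v ⟨m, h⟩ else 0 := by
  rw [finsetSum_coeff]
  split_ifs with h
  · rw [Finset.sum_eq_single ⟨m, h⟩]
    · simp
    · intro k _ hk
      have : m ≠ k := fun e => hk (Fin.ext e.symm)
      simp [coeff_X_pow, this]
    · simp
  · refine Finset.sum_eq_zero fun k _ => ?_
    have : m ≠ k := by omega
    simp [coeff_X_pow, this]

/-- Reducing `x · p` modulo a monic `f` of degree `n > deg p` takes at most one subtraction. -/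
theorem X_mul_modByMonic_eq_sub {n : ℕ} {f : ℤ[X]} (hf : f.Monic) (hfdeg : f.natDegree = n)
    (v : Fin n → ℤ) (l : Fin n) (hl : (l : ℕ) + 1 = n) :
    (X * ∑ k : Fin n, C (v k) * X ^ (k : ℕ)) %ₘ f =
      X * (∑ k : Fin n, C (v k) * X ^ (k : ℕ)) - C (v l) * f := by
  refine (div_modByMonic_unique (C (v l)) _ hf ⟨by ring, ?_⟩).2
  rw [degree_eq_natDegree hf.ne_zero, hfdeg, degree_lt_iff_coeff_zero]
  intro m hm
  obtain ⟨m, rfl⟩ : ∃ q, m = q + 1 := ⟨m - 1, by omega⟩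
  rw [coeff_sub, coeff_X_mul, coeff_C_mul, coeff_sum_C_mul_X_pow]
  rcases hm.eq_or_lt with h | h
  · have h1 : f.coeff (m + 1) = 1 := by rw [← h, ← hfdeg]; exact hf
    have hlm : (⟨m, by omega⟩ : Fin n) = l := Fin.ext (by simp; omega)
    rw [dif_pos (by omega), h1, hlm, mul_one, sub_self]
  · rw [dif_neg (by omega), coeff_eq_zero_of_natDegree_lt (by omega)]
    simp

theorem sum_coeff_X_mul_modByMonic_mul_pow {n : ℕ} {f : ℤ[X]} (hf : f.Monic)
    (hfdeg : f.natDegree = n) (v : Fin n → ℤ) (l : Fin n) (hl : (l : ℕ) + 1 = n) (β : ℤ) :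
    ∑ j : Fin n, ((X * ∑ k : Fin n, C (v k) * X ^ (k : ℕ)) %ₘ f).coeff (j : ℕ) * β ^ (j : ℕ) =
      β * ∑ j : Fin n, v j * β ^ (j : ℕ) - v l * f.eval β := by
  have hf1 : f ≠ 1 := fun h => by
    rw [h, natDegree_one] at hfdeg
    exact absurd l.isLt (by omega)
  have hdeg : ((X * ∑ k : Fin n, C (v k) * X ^ (k : ℕ)) %ₘ f).natDegree < n :=
    (natDegree_modByMonic_lt _ hf hf1).trans_eq hfdeg
  rw [Fin.sum_univ_eq_sum_range
    (fun j => ((X * ∑ k : Fin n, C (v k) * X ^ (k : ℕ)) %ₘ f).coeff j * β ^ j),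
    ← eval_eq_sum_range' hdeg, X_mul_modByMonic_eq_sub hf hfdeg v l hl]
  simp [eval_finsetSum]

/-- For a lower-triangular matrix with nonzero diagonal, a combination of the rows that vanishes
beyond column `k` only involves the rows up to `k`. -/
theorem coeff_eq_zero_of_lowerTriangular {n : ℕ} {H : Matrix (Fin n) (Fin n) ℤ}
    (hdiag : ∀ i, H i i ≠ 0) (hupper : ∀ j i, j < i → H j i = 0) {c : Fin n → ℤ} {k : ℕ}
    (hc : ∀ j : Fin n, k < j → ∑ i, c i * H i j = 0) (j : Fin n) (hj : k < j) : c j = 0 := by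
  induction j using WellFoundedGT.induction with
  | ind j ih =>
    have h := hc j hj
    rw [Finset.sum_eq_single j] at h
    · exact (mul_eq_zero.mp h).resolve_right (hdiag j)
    · intro i _ hij
      rcases hij.lt_or_gt with h' | h'
      · rw [hupper i j h', mul_zero]
      · rw [ih i h' (hj.trans h'), zero_mul]
    · simp

/-- Multiplying the `k`-th row polynomial by `x` stays in the span of the rows. -/
theorem exists_row_relation {n : ℕ} {f : ℤ[X]} (hf : f.Monic) (hfdeg : f.natDegree = n)
    {H : Matrix (Fin n) (Fin n) ℤ}
    (hclosed : ∀ v : Fin n → ℤ,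
      v ∈ Submodule.span ℤ (Set.range fun i : Fin n => H i) →
      (fun j : Fin n => ((X * ∑ k : Fin n, C (v k) * X ^ (k : ℕ)) %ₘ f).coeff (j : ℕ))
        ∈ Submodule.span ℤ (Set.range fun i : Fin n => H i))
    (l : Fin n) (hl : (l : ℕ) + 1 = n) (β : ℤ) (k : Fin n) :
    ∃ c : Fin n → ℤ,
      (∀ j : Fin n, ∑ i, c i * H i j =
        ((X * ∑ m : Fin n, C (H k m) * X ^ (m : ℕ)) %ₘ f).coeff (j : ℕ)) ∧
      ∑ i, c i * ∑ j : Fin n, H i j * β ^ (j : ℕ) =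
        β * ∑ j : Fin n, H k j * β ^ (j : ℕ) - H k l * f.eval β := by
  obtain ⟨c, hc⟩ := (Submodule.mem_span_range_iff_exists_fun ℤ).mp
    (hclosed (H k) (Submodule.subset_span ⟨k, rfl⟩))
  have hc' : ∀ j : Fin n, ∑ i, c i * H i j =
      ((X * ∑ m : Fin n, C (H k m) * X ^ (m : ℕ)) %ₘ f).coeff (j : ℕ) := fun j => by
    simpa using congrFun hc j
  refine ⟨c, hc', ?_⟩
  rw [← sum_coeff_X_mul_modByMonic_mul_pow hf hfdeg (H k) l hl β]
  simp_rw [← hc', Finset.sum_mul, Finset.mul_sum, mul_assoc]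
  exact Finset.sum_comm

/-- If `k` is not the last index, the relation for `x · H k` involves only the rows up to `k + 1`,
and its leading coefficient is the quotient of consecutive diagonal entries. -/
theorem exists_succ_row_relation {n : ℕ} {f : ℤ[X]} (hf : f.Monic) (hfdeg : f.natDegree = n)
    {H : Matrix (Fin n) (Fin n) ℤ}
    (hdiag : ∀ i, H i i ≠ 0) (hupper : ∀ j i, j < i → H j i = 0)
    (hclosed : ∀ v : Fin n → ℤ,
      v ∈ Submodule.span ℤ (Set.range fun i : Fin n => H i) →
      (fun j : Fin n => ((X * ∑ k : Fin n, C (v k) * X ^ (k : ℕ)) %ₘ f).coeff (j : ℕ))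
        ∈ Submodule.span ℤ (Set.range fun i : Fin n => H i))
    (β : ℤ) (k : ℕ) (hk : k + 1 < n) :
    ∃ c : Fin n → ℤ, (∀ j : Fin n, k + 1 < (j : ℕ) → c j = 0) ∧
      c ⟨k + 1, hk⟩ * H ⟨k + 1, hk⟩ ⟨k + 1, hk⟩ = H ⟨k, by omega⟩ ⟨k, by omega⟩ ∧
      ∑ i, c i * ∑ j : Fin n, H i j * β ^ (j : ℕ) =
        β * ∑ j : Fin n, H ⟨k, by omega⟩ j * β ^ (j : ℕ) := by
  have hl : (n - 1) + 1 = n := by omega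
  obtain ⟨c, hc, hE⟩ := exists_row_relation hf hfdeg hclosed ⟨n - 1, by omega⟩ hl β ⟨k, by omega⟩
  have h0 : H ⟨k, by omega⟩ ⟨n - 1, by omega⟩ = 0 := hupper _ _ (by simp; omega)
  rw [X_mul_modByMonic_eq_sub hf hfdeg _ ⟨n - 1, by omega⟩ hl, h0] at hc
  rw [h0, zero_mul, sub_zero] at hE
  have hcoeff : ∀ m (hm : m + 1 < n),
      ∑ i, c i * H i ⟨m + 1, hm⟩ = H ⟨k, by omega⟩ ⟨m, by omega⟩ := fun m hm => by
    rw [hc, C_0, zero_mul, sub_zero, coeff_X_mul, coeff_sum_C_mul_X_pow, dif_pos]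
  have hzero : ∀ j : Fin n, k + 1 < (j : ℕ) → c j = 0 :=
    coeff_eq_zero_of_lowerTriangular hdiag hupper fun j hj => by
      obtain ⟨_ | m, hm⟩ := j
      · simp at hj
      · rw [hcoeff m hm]
        exact hupper _ _ (by simpa using hj)
  refine ⟨c, hzero, ?_, hE⟩
  rw [← hcoeff k hk, Finset.sum_eq_single ⟨k + 1, hk⟩]
  · intro i _ hi
    rcases hi.lt_or_gt with h | h
    · rw [hupper _ _ h, mul_zero]
    · rw [hzero i h, zero_mul]
  · simp

/-- Let `H` be a nonsingular integer matrix in Hermite Normal Form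
(lower-triangular convention) whose rows span an ideal lattice for a monic `f` of degree
`n`, and let `β` be the integer root of `h_{2,1} + h_{2,2}·x`. Then the integer
`h_{1,1}/h_{2,2}` divides `f(β)`. -/
theorem hnf_ideal_lattice_f_at_root
    (n : ℕ) (hn : 2 ≤ n)
    (f : Polynomial ℤ) (hf : f.Monic) (hfdeg : f.natDegree = n)
    (H : Matrix (Fin n) (Fin n) ℤ)
    (hdet : H.det ≠ 0)
    (hdiagpos : ∀ i : Fin n, 0 < H i i)
    (hupper : ∀ j i : Fin n, j < i → H j i = 0)
    (hreduced : ∀ i j : Fin n, i < j → 0 ≤ H j i ∧ H j i < H i i)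
    (hclosed : ∀ v : Fin n → ℤ,
      v ∈ Submodule.span ℤ (Set.range fun i : Fin n => H i) →
      (fun j : Fin n => ((X * ∑ k : Fin n, C (v k) * X ^ (k : ℕ)) %ₘ f).coeff (j : ℕ))
        ∈ Submodule.span ℤ (Set.range fun i : Fin n => H i))
    (β : ℤ)
    (hβ : H ⟨1, by omega⟩ ⟨0, by omega⟩ + H ⟨1, by omega⟩ ⟨1, by omega⟩ * β = 0) :
    (H ⟨0, by omega⟩ ⟨0, by omega⟩ / H ⟨1, by omega⟩ ⟨1, by omega⟩) ∣ f.eval β := by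
  have hdiag : ∀ i, H i i ≠ 0 := fun i => (hdiagpos i).ne'
  set e : Fin n → ℤ := fun i => ∑ j : Fin n, H i j * β ^ (j : ℕ) with he
  obtain ⟨N, hN⟩ : H ⟨1, by omega⟩ ⟨1, by omega⟩ ∣ H ⟨0, by omega⟩ ⟨0, by omega⟩ := by
    obtain ⟨c, -, hc, -⟩ := exists_succ_row_relation hf hfdeg hdiag hupper hclosed β 0 (by omega)
    exact ⟨_, by rw [← hc]; exact mul_comm _ _⟩
  rw [hN, Int.mul_ediv_cancel_left _ (hdiag _)]
  have he0 : e ⟨0, by omega⟩ = H ⟨0, by omega⟩ ⟨0, by omega⟩ := by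
    simp only [he]
    rw [Finset.sum_eq_single ⟨0, by omega⟩]
    · simp
    · intro j _ hj
      have : (j : ℕ) ≠ 0 := fun h => hj (Fin.ext h)
      rw [hupper _ j (by rw [Fin.lt_def]; simp; omega), zero_mul]
    · simp
  have he1 : e ⟨1, by omega⟩ = 0 := by
    rw [← hβ]
    simp only [he]
    rw [Fintype.sum_eq_add (⟨0, by omega⟩ : Fin n) ⟨1, by omega⟩ (by simp)]
    · simp
    · rintro j ⟨h0, h1⟩
      have h0' : (j : ℕ) ≠ 0 := fun h => h0 (Fin.ext h)
      have h1' : (j : ℕ) ≠ 1 := fun h => h1 (Fin.ext h)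
      rw [hupper _ j (by rw [Fin.lt_def]; simp; omega), zero_mul]
  have key : ∀ k (hk : k + 1 < n) (i : Fin n), (i : ℕ) ≤ k + 1 →
      N * H ⟨k + 1, hk⟩ ⟨k + 1, hk⟩ ∣ e i := by
    intro k
    induction k with
    | zero =>
      rintro hk ⟨i, hi⟩ hik
      have : i = 0 ∨ i = 1 := by simp at hik; omega
      rcases this with rfl | rfl
      · rw [he0, hN, mul_comm]
      · rw [he1]
        exact dvd_zero _
    | succ k ih =>
      intro hk i hik
      obtain ⟨c, hc0, hc, hE⟩ :=
        exists_succ_row_relation hf hfdeg hdiag hupper hclosed β (k + 1) hk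
      have ih' := ih (by omega)
      rcases hik.lt_or_eq with h | h
      · exact (mul_dvd_mul_left N ⟨_, by rw [← hc]; exact mul_comm _ _⟩).trans (ih' i (by omega))
      · obtain rfl : i = ⟨k + 1 + 1, hk⟩ := Fin.ext h
        have hne : c ⟨k + 1 + 1, hk⟩ ≠ 0 := fun h0 => by
          rw [h0, zero_mul] at hc
          exact hdiag _ hc.symm
        refine (mul_dvd_mul_iff_left hne).mp ?_
        rw [mul_left_comm, hc]
        have hsum : N * H ⟨k + 1, by omega⟩ ⟨k + 1, by omega⟩ ∣ ∑ i, c i * e i :=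
          hE ▸ (ih' ⟨k + 1, by omega⟩ le_rfl).mul_left β
        rw [← Finset.add_sum_erase _ _ (Finset.mem_univ ⟨k + 1 + 1, hk⟩)] at hsum
        refine (dvd_add_left (Finset.dvd_sum fun i hi => ?_)).mp hsum
        have hi' : (i : ℕ) ≠ k + 1 + 1 := fun h => Finset.ne_of_mem_erase hi (Fin.ext h)
        by_cases hik : (i : ℕ) ≤ k + 1
        · exact (ih' i hik).mul_left _
        · rw [hc0 i (by omega), zero_mul]
          exact dvd_zero _
  obtain ⟨m, rfl⟩ : ∃ m, n = m + 1 + 1 := ⟨n - 2, by omega⟩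
  obtain ⟨c, -, hE⟩ := exists_row_relation hf hfdeg hclosed ⟨m + 1, by omega⟩ rfl β ⟨m + 1, by omega⟩
  have hrow : ∀ i, N * H ⟨m + 1, by omega⟩ ⟨m + 1, by omega⟩ ∣ e i := fun i =>
    key m (by omega) i (by omega)
  have hdvd : N * H ⟨m + 1, by omega⟩ ⟨m + 1, by omega⟩ ∣
      H ⟨m + 1, by omega⟩ ⟨m + 1, by omega⟩ * f.eval β := by
    rw [← sub_eq_iff_eq_add.mpr (sub_eq_iff_eq_add'.mp hE.symm)]
    exact dvd_sub ((hrow _).mul_left β) (Finset.dvd_sum fun i _ => (hrow i).mul_left _)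
  rw [mul_comm] at hdvd
  exact (mul_dvd_mul_iff_left (hdiag _)).mp hdvd
end

section
/- Let n be a power of 2, f = x^n + 1, and v ∈ ℤ[x] of degree < n with d = Res(v,f) ≠ 0. Let w = w_0 + w_1x + ⋯ + w_{n−1}x^{n−1} ∈ ℤ[x] be the polynomial of degree < n with v(x)·w(x) ≡ d (mod x^n + 1). If there exists r ∈ ℤ such that x − r lies in the ideal I generated by v in ℤ[x]/(x^n+1), then there exists an index i with 0 ≤ i ≤ n−1 such that gcd(w_i, d) = 1. -/
open Polynomial Matrix

/-- The Sylvester matrix of `a` and `b` (with `m = deg a`, `n = deg b`):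
an `(n + m) × (n + m)` integer matrix whose first `n` rows are the coefficient
vectors of `a, x·a, …, x^{n-1}·a` and whose last `m` rows are the coefficient
vectors of `b, x·b, …, x^{m-1}·b`. -/
noncomputable def sylvesterMatrix (a b : Polynomial ℤ) :
    Matrix (Fin (b.natDegree + a.natDegree)) (Fin (b.natDegree + a.natDegree)) ℤ :=
  Matrix.of fun i j =>
    if (i : ℕ) < b.natDegree then
      (if (i : ℕ) ≤ (j : ℕ) then a.coeff ((j : ℕ) - (i : ℕ)) else 0)
    else
      (if (i : ℕ) - b.natDegree ≤ (j : ℕ) then b.coeff ((j : ℕ) - ((i : ℕ) - b.natDegree)) else 0)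

/-- The resultant of two integer polynomials: the determinant of their Sylvester matrix. -/
noncomputable def resultantZ (a b : Polynomial ℤ) : ℤ := (sylvesterMatrix a b).det

/-- If the cokernel of the transpose of `S` is cyclic, generated by the `k`-th standard basis vector,
and is annihilated by `t`, then `det S` divides `t`. -/
lemma Matrix.det_dvd_of_cyclic_cokernel {ι R : Type*} [Fintype ι] [DecidableEq ι] [CommRing R]
    (S A : Matrix ι ι R) (k : ι) (b c : ι → R) (t : R)
    (hA : A * S = 1 - vecMulVec b (Pi.single k 1))
    (hc : c ᵥ* S = t • Pi.single k 1) : S.det ∣ t := by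
  have det_rank_one (u : ι → R) : (1 - vecMulVec u (Pi.single k 1)).det = 1 - u k := by
    rw [sub_eq_add_neg, ← neg_vecMulVec, vecMulVec_eq Unit,
      det_one_add_replicateCol_mul_replicateRow]
    simp [sub_eq_add_neg]
  have h₁ : S.det ∣ 1 - b k := by
    rw [← det_rank_one, ← hA, det_mul]
    exact dvd_mul_left _ _
  have h₂ : S.det ∣ 1 - (b k - t) := by
    have h : (A + vecMulVec (Pi.single k 1) c) * S =
        1 - vecMulVec (b - t • Pi.single k 1) (Pi.single k 1) := by
      rw [add_mul, hA, vecMulVec_mul, hc, sub_vecMulVec, smul_vecMulVec, vecMulVec_smul]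
      abel
    have h' := det_rank_one (b - t • Pi.single k 1)
    rw [← h, det_mul] at h'
    simp only [Pi.sub_apply, Pi.smul_apply, Pi.single_eq_same, smul_eq_mul, mul_one] at h'
    rw [← h']
    exact dvd_mul_left _ _
  have h := dvd_sub h₂ h₁
  rwa [show 1 - (b k - t) - (1 - b k) = t by ring] at h

lemma Polynomial.coeff_mul_eq_sum_fin {R : Type*} [CommSemiring R] (p a : R[X]) (n j : ℕ)
    (hp : p.degree < n) :
    (p * a).coeff j = ∑ i : Fin n, p.coeff i * if (i : ℕ) ≤ j then a.coeff (j - i) else 0 := by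
  rw [Fin.sum_univ_eq_sum_range (fun i => p.coeff i * if i ≤ j then a.coeff (j - i) else 0)]
  have h : p = ∑ i ∈ Finset.range n, C (p.coeff i) * X ^ i := by
    ext m
    simp only [finsetSum_coeff, coeff_C_mul, coeff_X_pow, mul_ite, mul_one, mul_zero,
      Finset.sum_ite_eq, Finset.mem_range]
    split_ifs with hm
    · rfl
    · exact coeff_eq_zero_of_degree_lt (hp.trans_le (by exact_mod_cast not_lt.mp hm))
  conv_lhs => rw [h]
  simp only [Finset.sum_mul, finsetSum_coeff, mul_assoc, coeff_C_mul, coeff_X_pow_mul']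

/-- Polynomials of small degree in the ideal `(a, b)`, with `b` monic, lie in the row span of the
Sylvester matrix. -/
lemma exists_vecMul_sylvesterMatrix (a b g : ℤ[X]) (hb : b.Monic)
    (hg : g.degree < (b.natDegree + a.natDegree : ℕ)) (h : g ∈ Ideal.span {a, b}) :
    ∃ c, c ᵥ* sylvesterMatrix a b = fun j : Fin _ => g.coeff j := by
  obtain ⟨p₀, q₀, h₀⟩ := Ideal.mem_span_pair.mp h
  obtain ⟨p, q, hpq, hp⟩ : ∃ p q, p * a + q * b = g ∧ p.degree < b.natDegree := by
    refine ⟨p₀ %ₘ b, q₀ + a * (p₀ /ₘ b), ?_, ?_⟩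
    · rw [← h₀]
      linear_combination a * modByMonic_add_div p₀ b
    · rw [← degree_eq_natDegree hb.ne_zero]
      exact degree_modByMonic_lt _ hb
  have hpa : (p * a).degree < (b.natDegree + a.natDegree : ℕ) := by
    rcases eq_or_ne p 0 with rfl | hp0
    · simp
    refine (degree_mul_le _ _).trans_lt ?_
    rw [degree_eq_natDegree hp0] at hp ⊢
    refine (add_le_add_right degree_le_natDegree _).trans_lt ?_
    have : p.natDegree < b.natDegree := by exact_mod_cast hp
    exact_mod_cast Nat.add_lt_add_right this _
  have hq : q.degree < a.natDegree := by
    have hqb : (q * b).degree < (b.natDegree + a.natDegree : ℕ) := by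
      rw [← eq_sub_iff_add_eq'] at hpq
      rw [hpq]
      exact (degree_sub_le _ _).trans_lt (max_lt hg hpa)
    rcases eq_or_ne q 0 with rfl | hq0
    · simp
    rw [hb.degree_mul, degree_eq_natDegree hq0, degree_eq_natDegree hb.ne_zero] at hqb
    rw [degree_eq_natDegree hq0]
    norm_cast at hqb ⊢
    omega
  refine ⟨fun i => if (i : ℕ) < b.natDegree then p.coeff i else q.coeff (i - b.natDegree), ?_⟩
  ext j
  rw [← hpq, coeff_add, coeff_mul_eq_sum_fin p a _ _ hp, coeff_mul_eq_sum_fin q b _ _ hq]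
  have castAdd_le (x : Fin b.natDegree) : Fin.castAdd a.natDegree x ≤ j ↔ (x : ℕ) ≤ j := Iff.rfl
  simp [vecMul, dotProduct, Fin.sum_univ_add, sylvesterMatrix, castAdd_le, Nat.add_comm (j : ℕ)]

/-- If `ℤ[x]/(a, b)` is generated by `1` as a group, then every integer in `(a, b)` is a multiple of
the resultant. -/
lemma resultantZ_dvd_of_mem_span (a b : ℤ[X]) (hb : b.Monic) (hb0 : 0 < b.natDegree) (r t : ℤ)
    (hr : X - C r ∈ Ideal.span {a, b}) (ht : C t ∈ Ideal.span {a, b}) : resultantZ a b ∣ t := by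
  let k : Fin (b.natDegree + a.natDegree) := ⟨0, by omega⟩
  have coeff_C_eq (s : ℤ) (j : Fin (b.natDegree + a.natDegree)) :
      (C s).coeff j = s * (Pi.single k 1 : _ → ℤ) j := by
    rw [coeff_C]
    simp [Pi.single_apply, k, Fin.ext_iff]
  have hrow (i : Fin (b.natDegree + a.natDegree)) :
      ∃ c, c ᵥ* sylvesterMatrix a b =
        fun j : Fin _ => (X ^ (i : ℕ) - C (r ^ (i : ℕ)) : ℤ[X]).coeff j := by
    refine exists_vecMul_sylvesterMatrix a b _ hb ?_ ?_
    · refine (degree_sub_le _ _).trans_lt (max_lt ?_ (degree_C_le.trans_lt ?_))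
      · rw [degree_X_pow]
        exact_mod_cast i.2
      · exact_mod_cast k.2
    · refine Ideal.mem_of_dvd _ ?_ hr
      rw [C_pow]
      exact sub_dvd_pow_sub_pow _ _ _
  choose A hA using hrow
  obtain ⟨c, hc⟩ := exists_vecMul_sylvesterMatrix a b (C t) hb
    (degree_C_le.trans_lt (by exact_mod_cast k.2)) ht
  refine det_dvd_of_cyclic_cokernel _ (of A) k (fun i => r ^ (i : ℕ)) c t ?_ ?_
  · ext i j
    have h := congrFun (hA i) j
    rw [mul_apply]
    simp only [vecMul, dotProduct] at h
    simp only [of_apply, Matrix.sub_apply, vecMulVec_apply]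
    rw [h, coeff_sub, coeff_C_eq, coeff_X_pow, one_apply]
    simp [Fin.ext_iff, eq_comm]
  · rw [hc]
    ext j
    exact coeff_C_eq t j

/-- If the top coefficient of `w` vanishes and `(X - r) w` is a multiple of a monic polynomial `f`
of degree `n > deg w`, then `w = 0`. -/
lemma Polynomial.eq_zero_of_monic_dvd_X_sub_C_mul {R : Type*} [CommRing R]
    {f w : R[X]} (hf : f.Monic) (r : R) (hw : w.degree < f.natDegree)
    (htop : w.coeff (f.natDegree - 1) = 0) (h : f ∣ (X - C r) * w) : w = 0 := by
  nontriviality R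
  rw [← (monic_X_sub_C r).mul_right_eq_zero_iff]
  by_contra h0
  refine hf.not_dvd_of_degree_lt h0 ?_ h
  have hw' : w.degree < (f.natDegree - 1 : ℕ) := by
    rw [degree_lt_iff_coeff_zero] at hw ⊢
    intro m hm
    rcases hm.eq_or_lt with rfl | hm
    · exact htop
    · exact hw m (by omega)
  rw [degree_eq_natDegree hf.ne_zero]
  rcases eq_or_ne w 0 with rfl | hw0
  · simp
  rw [(monic_X_sub_C r).degree_mul_comm, (monic_X_sub_C r).degree_mul, degree_X_sub_C]
  rw [degree_eq_natDegree hw0] at hw' ⊢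
  norm_cast at hw' ⊢
  omega

/-- Let `n` be a power of 2, `f = x^n+1`, `v ∈ ℤ[x]` of degree `< n`
with `d = Res(v,f) ≠ 0`, and `w` the polynomial of degree `< n` with
`v·w ≡ d (mod x^n+1)`. If some `x − r` (`r ∈ ℤ`) lies in the ideal `I` generated by `v`
in `ℤ[x]/(x^n+1)`, then `gcd(w_i, d) = 1` for some index `0 ≤ i ≤ n−1`. -/
theorem exists_coprime_coeff_of_linear_in_ideal
    (n : ℕ) (hn : ∃ k : ℕ, n = 2 ^ k)
    (v : Polynomial ℤ) (hv : v.natDegree < n)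
    (d : ℤ) (hd : d = resultantZ v (X ^ n + 1)) (hd0 : d ≠ 0)
    (w : Polynomial ℤ) (hw : w.natDegree < n)
    (hvw : ((X : Polynomial ℤ) ^ n + 1) ∣ v * w - C d)
    (hr : ∃ r : ℤ, Ideal.Quotient.mk (Ideal.span {(X : Polynomial ℤ) ^ n + 1}) (X - C r) ∈
      Ideal.span {Ideal.Quotient.mk (Ideal.span {(X : Polynomial ℤ) ^ n + 1}) v}) :
    ∃ i : ℕ, i < n ∧ Int.gcd (w.coeff i) d = 1 := by
  have hn0 : 0 < n := by omega
  have hf : (X ^ n + 1 : ℤ[X]).Monic := monic_X_pow_add_C 1 hn0.ne'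
  have hfn : (X ^ n + 1 : ℤ[X]).natDegree = n := natDegree_X_pow_add_C (r := 1)
  obtain ⟨r, hr⟩ := hr
  obtain ⟨u, hu⟩ := Ideal.mem_span_singleton'.mp hr
  obtain ⟨u, rfl⟩ := Ideal.Quotient.mk_surjective u
  rw [← map_mul, Ideal.Quotient.eq, Ideal.mem_span_singleton] at hu
  obtain ⟨q, hq⟩ := hu
  have hrmem : X - C r ∈ Ideal.span {v, (X ^ n + 1 : ℤ[X])} :=
    Ideal.mem_span_pair.mpr ⟨u, -q, by linear_combination hq⟩
  refine ⟨n - 1, by omega, ?_⟩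
  by_contra hgcd
  obtain ⟨p, hp, hpg⟩ := Nat.exists_prime_and_dvd hgcd
  have hpw : (p : ℤ) ∣ w.coeff (n - 1) :=
    (Int.natCast_dvd_natCast.mpr hpg).trans (Int.gcd_dvd_left _ _)
  obtain ⟨t, ht⟩ : (p : ℤ) ∣ d := (Int.natCast_dvd_natCast.mpr hpg).trans (Int.gcd_dvd_right _ _)
  have hw0 : w.map (Int.castRingHom (ZMod p)) = 0 := by
    have := Fact.mk hp
    have hfn' : ((X ^ n + 1 : ℤ[X]).map (Int.castRingHom (ZMod p))).natDegree = n := by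
      rw [hf.natDegree_map, hfn]
    refine eq_zero_of_monic_dvd_X_sub_C_mul (hf.map (Int.castRingHom (ZMod p))) (r : ZMod p) ?_ ?_ ?_
    · rw [hfn']
      refine degree_map_le.trans_lt (degree_le_natDegree.trans_lt ?_)
      exact_mod_cast hw
    · rw [hfn', coeff_map]
      exact (ZMod.intCast_zmod_eq_zero_iff_dvd _ _).mpr hpw
    · obtain ⟨s, hs⟩ := hvw
      have h : (X - C r) * w = (X ^ n + 1) * (u * s - q * w) + C d * u := by
        linear_combination u * hs - w * hq
      have h' := congrArg (Polynomial.map (Int.castRingHom (ZMod p))) h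
      have hd' : ((d : ℤ) : ZMod p) = 0 := by simp [ht]
      rw [Polynomial.map_mul, Polynomial.map_add, Polynomial.map_mul, Polynomial.map_mul, map_C,
        Polynomial.map_sub, map_X, map_C, eq_intCast, eq_intCast, hd', C_0, zero_mul,
        add_zero] at h'
      rw [h']
      exact dvd_mul_right _ _
  obtain ⟨w', rfl⟩ : C (p : ℤ) ∣ w := by
    rw [C_dvd_iff_dvd_coeff]
    intro i
    rw [← ZMod.intCast_zmod_eq_zero_iff_dvd]
    simpa using congrArg (fun g => coeff g i) hw0
  have hp0 : (p : ℤ) ≠ 0 := by exact_mod_cast hp.ne_zero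
  have htmem : C t ∈ Ideal.span {v, (X ^ n + 1 : ℤ[X])} := by
    have h : (X ^ n + 1 : ℤ[X]) ∣ v * w' - C t := by
      rw [← modByMonic_eq_zero_iff_dvd hf] at hvw ⊢
      rw [show v * (C (p : ℤ) * w') - C d = (p : ℤ) • (v * w' - C t) by
        rw [ht, C_mul, smul_eq_C_mul]; ring, smul_modByMonic] at hvw
      exact (smul_eq_zero.mp hvw).resolve_left hp0
    obtain ⟨s, hs⟩ := h
    exact Ideal.mem_span_pair.mpr ⟨w', -s, by linear_combination hs⟩
  have hdt : d ∣ t := hd ▸ resultantZ_dvd_of_mem_span v _ hf (by omega) r t hrmem htmem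
  have ht0 : t ≠ 0 := by
    rintro rfl
    exact hd0 (by simpa using ht)
  have hpt : (p : ℤ) * t ∣ 1 * t := by rwa [← ht, one_mul]
  exact hp.one_lt.ne' (by
    exact_mod_cast Int.eq_one_of_dvd_one (by positivity) ((mul_dvd_mul_iff_right ht0).mp hpt))
end

section
/- Let n be a power of 2, f = x^n + 1, and v ∈ ℤ[x] of degree < n with d = Res(v,f) ≠ 0. If r ∈ ℤ is such that x − r lies in the ideal I generated by v in ℤ[x]/(x^n+1), then r is a root of f modulo d, i.e., r^n ≡ −1 (mod d). -/
open Polynomial Matrix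

theorem resultantZ_eq_resultant (a b : Polynomial ℤ) : resultantZ a b = b.resultant a := by
  rw [resultantZ, Polynomial.resultant, ← Matrix.det_transpose]
  congr 1
  ext i j
  induction j using Fin.addCases with
  | left j =>
    have hj := j.isLt
    simp only [sylvesterMatrix, Polynomial.sylvester, Matrix.transpose_apply, Matrix.of_apply,
      Fin.addCases_left, Fin.val_castAdd, Set.mem_Icc, hj, if_true]
    split_ifs with h₁ h₂ h₂
    · rfl
    · exact coeff_eq_zero_of_natDegree_lt (by omega)
    · omega
    · rfl
  | right j =>
    simp only [sylvesterMatrix, Polynomial.sylvester, Matrix.transpose_apply, Matrix.of_apply,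
      Fin.addCases_right, Fin.val_natAdd, Set.mem_Icc, Nat.add_sub_cancel_left,
      Nat.not_lt.mpr (Nat.le_add_right _ _), if_false]
    split_ifs with h₁ h₂ h₂
    · rfl
    · exact coeff_eq_zero_of_natDegree_lt (by omega)
    · omega
    · rfl

/-- For monic `f`, the resultant with `v` divides `f(r)` whenever `x - r` is in the ideal
generated by `v` and `f`. -/
theorem resultant_dvd_eval_of_mul_add_mul_eq {R : Type*} [CommRing R] {f v w q : Polynomial R}
    {r : R} (hf : f.Monic) (h : v * w + f * q = X - C r) :
    f.resultant v ∣ f.eval r := by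
  have hc : f.coeff f.natDegree = 1 := hf
  set N := v.natDegree + w.natDegree
  have key : f.resultant (v * w) f.natDegree (N + (1 + q.natDegree + f.natDegree)) =
      f.resultant (X - C r) f.natDegree (1 + (N + q.natDegree + f.natDegree)) := by
    rw [← h, show 1 + (N + q.natDegree + f.natDegree) = N + (1 + q.natDegree + f.natDegree) by
      ring, resultant_add_mul_right _ _ _ _ _ (by omega) le_rfl]
  rw [resultant_add_right_deg _ _ _ _ _ natDegree_mul_le, resultant_mul_right _ _ _ _ le_rfl,
    resultant_add_right_deg _ _ _ _ _ (natDegree_X_sub_C_le r),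
    resultant_X_sub_C_right _ _ _ le_rfl, hc, one_pow, one_pow, one_mul, one_mul] at key
  have h_dvd : f.resultant v ∣ (-1) ^ f.natDegree * f.eval r := key ▸ dvd_mul_right _ _
  exact ((isUnit_one.neg.pow _).dvd_mul_left).mp h_dvd

/-- Let `n` be a power of 2, `f = x^n+1`, and `v ∈ ℤ[x]` of degree
`< n` with `d = Res(v,f) ≠ 0`. If `r ∈ ℤ` is such that `x − r` lies in the ideal `I`
generated by `v` in `ℤ[x]/(x^n+1)`, then `r` is a root of `f` modulo `d`, i.e.
`r^n ≡ −1 (mod d)`. -/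
theorem root_mod_d_of_linear_in_ideal
    (n : ℕ) (hn : ∃ k : ℕ, n = 2 ^ k)
    (v : Polynomial ℤ) (hv : v.natDegree < n)
    (d : ℤ) (hd : d = resultantZ v (X ^ n + 1)) (hd0 : d ≠ 0)
    (r : ℤ)
    (hr : Ideal.Quotient.mk (Ideal.span {(X : Polynomial ℤ) ^ n + 1}) (X - C r) ∈
      Ideal.span {Ideal.Quotient.mk (Ideal.span {(X : Polynomial ℤ) ^ n + 1}) v}) :
    r ^ n ≡ -1 [ZMOD d] := by
  have hn0 : n ≠ 0 := by omega
  obtain ⟨w', hw⟩ := Ideal.mem_span_singleton'.mp hr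
  obtain ⟨w, rfl⟩ := Ideal.Quotient.mk_surjective w'
  rw [← map_mul, eq_comm, Ideal.Quotient.eq, Ideal.mem_span_singleton] at hw
  obtain ⟨q, hq⟩ := hw
  have h_dvd := resultant_dvd_eval_of_mul_add_mul_eq (f := X ^ n + 1) (v := v) (w := w) (q := q)
    (r := r) (by simpa using monic_X_pow_add_C (1 : ℤ) hn0) (by rw [← hq]; ring)
  rw [← resultantZ_eq_resultant, ← hd] at h_dvd
  exact (Int.modEq_iff_dvd.mpr (by simpa using h_dvd)).symm
end
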